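/- For a symmetric memoryless channel of capacity C and a camellia code of rate R < C with expansion δ_n = C − R − Ω(1) and correlation ρ_n = o_n(1), the local error probability satisfies P_loc = O(√ρ_n) = o_n(1); in particular P_bit = o_n(1). -/

import Mathlib

open Finset

/-- Probability of a single noise symbol `(e, b)` under the symmetric-channel mixture with
mixing weights `q` and crossover probabilities `eps`: the channel outputs
`Y_i = (ε_i, X_i + w_i)` with `w_i ~ Ber(eps ε_i)`. -/
noncomputable def noiseP {E : Type*} (q eps : E → ℝ) (z : E × ZMod 2) : ℝ :=
  q z.1 * (if z.2 = 1 then eps z.1 else 1 - eps z.1)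

/-- Binary entropy (base 2). -/
noncomputable def binEnt (p : ℝ) : ℝ :=
  -(p * Real.logb 2 p) - ((1 - p) * Real.logb 2 (1 - p))

/-- Capacity of the symmetric channel that is the mixture of the `BSC(eps e)`
with weights `q e`. -/
noncomputable def capacity {E : Type*} [Fintype E] (q eps : E → ℝ) : ℝ :=
  ∑ e, q e * (1 - binEnt (eps e))

open Classical in
/-- Joint probability of a (codeword, noise) pair: the codeword is uniform on the linear
code `C`, the noise is i.i.d. across coordinates. -/
noncomputable def jointP {ι E : Type*} [Fintype ι] [Fintype E]
    (C : Submodule (ZMod 2) (ι → ZMod 2)) (q eps : E → ℝ)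
    (ω : ↥C × (ι → E × ZMod 2)) : ℝ :=
  (Nat.card C : ℝ)⁻¹ * ∏ i, noiseP q eps (ω.2 i)

/-- Channel output on input codeword `x` and noise realization `z`. -/
def outputOf {ι E : Type*} (x : ι → ZMod 2) (z : ι → E × ZMod 2) : ι → E × ZMod 2 :=
  fun i => ((z i).1, x i + (z i).2)

open Classical in
/-- Posterior weight of the event `X_i = b` and the outputs on `S` agree with `y`. -/
noncomputable def post {ι E : Type*} [Fintype ι] [Fintype E]
    (C : Submodule (ZMod 2) (ι → ZMod 2)) (q eps : E → ℝ) (i : ι) (S : Finset ι)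
    (b : ZMod 2) (y : ι → E × ZMod 2) : ℝ :=
  ∑ ω : ↥C × (ι → E × ZMod 2),
    if (ω.1 : ι → ZMod 2) i = b ∧ ∀ j ∈ S, outputOf (ω.1 : ι → ZMod 2) ω.2 j = y j
    then jointP C q eps ω else 0

open Classical in
/-- ML (MAP) decoding of bit `i` from the outputs on `S`. -/
noncomputable def decodeBit {ι E : Type*} [Fintype ι] [Fintype E]
    (C : Submodule (ZMod 2) (ι → ZMod 2)) (q eps : E → ℝ) (i : ι) (S : Finset ι)
    (y : ι → E × ZMod 2) : ZMod 2 :=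
  if post C q eps i S 1 y > post C q eps i S 0 y then 1 else 0

open Classical in
/-- Probability that ML decoding of bit `i` from the outputs on `S` is wrong. -/
noncomputable def errP {ι E : Type*} [Fintype ι] [Fintype E]
    (C : Submodule (ZMod 2) (ι → ZMod 2)) (q eps : E → ℝ) (i : ι) (S : Finset ι) : ℝ :=
  ∑ ω : ↥C × (ι → E × ZMod 2),
    if decodeBit C q eps i S (outputOf (ω.1 : ι → ZMod 2) ω.2) ≠ (ω.1 : ι → ZMod 2) i
    then jointP C q eps ω else 0

/-- `P_loc,i` : error probability of ML decoding of `X_i` from all other outputs. -/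
noncomputable def Ploc {ι E : Type*} [Fintype ι] [DecidableEq ι] [Fintype E]
    (C : Submodule (ZMod 2) (ι → ZMod 2)) (q eps : E → ℝ) (i : ι) : ℝ :=
  errP C q eps i (Finset.univ.erase i)

/-- `P_bit,i` : error probability of ML decoding of `X_i` from the full output. -/
noncomputable def Pbit {ι E : Type*} [Fintype ι] [Fintype E]
    (C : Submodule (ZMod 2) (ι → ZMod 2)) (q eps : E → ℝ) (i : ι) : ℝ :=
  errP C q eps i Finset.univ

/-- Rate of a linear code. -/
noncomputable def rate {ι : Type*} [Fintype ι] (C : Submodule (ZMod 2) (ι → ZMod 2)) : ℝ :=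
  (Module.finrank (ZMod 2) ↥C : ℝ) / (Fintype.card ι)

/-- Validity of the symmetric-channel parameters: `q` is a probability vector and each
crossover probability lies in `[0, 1/2]`. -/
def ChannelValid {E : Type*} [Fintype E] (q eps : E → ℝ) : Prop :=
  (∀ e, 0 ≤ q e) ∧ (∑ e, q e = 1) ∧ (∀ e, 0 ≤ eps e ∧ eps e ≤ 1 / 2)

/-- A linear code is transitive if its automorphism group acts transitively on coordinates. -/
def TransitiveCode {ι : Type*} (C : Submodule (ZMod 2) (ι → ZMod 2)) : Prop :=
  ∀ i j : ι, ∃ σ : Equiv.Perm ι, (∀ x ∈ C, x ∘ σ ∈ C) ∧ σ i = j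

/-- Rate of the restriction of the code `C` to the subset `P` of coordinates. -/
noncomputable def restrRate {ι : Type*} [Fintype ι] (C : Submodule (ZMod 2) (ι → ZMod 2))
    (P : Finset ι) : ℝ :=
  (Module.finrank (ZMod 2)
    ↥(C.map (LinearMap.funLeft (ZMod 2) (ZMod 2) (fun p : ↥P => (p : ι)))) : ℝ) / (P.card : ℝ)

section IidExpectation
open scoped Classical

variable {ι Z : Type*} [Fintype Z]

/-- Average of `h` over the `k`-th coordinate. -/
noncomputable def avgAt (p : Z → ℝ) (k : ι) (h : (ι → Z) → ℝ) (z : ι → Z) : ℝ :=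
  ∑ w, p w * h (Function.update z k w)

lemma avgAt_mul {p : Z → ℝ} (k : ι) (g h : (ι → Z) → ℝ)
    (hh : ∀ z w, h (Function.update z k w) = h z) (z : ι → Z) :
    avgAt p k (fun z => g z * h z) z = avgAt p k g z * h z := by
  simp only [avgAt, hh, Finset.sum_mul, mul_assoc]

lemma avgAt_update (p : Z → ℝ) (k : ι) (h : (ι → Z) → ℝ) (z : ι → Z) (w : Z) :
    avgAt p k h (Function.update z k w) = avgAt p k h z := by
  simp [avgAt]

lemma avgAt_eq_self {p : Z → ℝ} (hp : ∑ w, p w = 1) {k : ι} {h : (ι → Z) → ℝ}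
    (hh : ∀ z w, h (Function.update z k w) = h z) (z : ι → Z) : avgAt p k h z = h z := by
  simp only [avgAt, hh]
  rw [← Finset.sum_mul, hp, one_mul]

lemma dependsOn_update {ι Z : Type*} {h : (ι → Z) → ℝ} {T : Set ι} (hh : DependsOn h T) {k : ι} (hk : k ∉ T)
    (z : ι → Z) (w : Z) : h (Function.update z k w) = h z :=
  hh fun _ hi => Function.update_of_ne (ne_of_mem_of_not_mem hi hk) _ _

variable [Fintype ι]

/-- Expectation of `h` when the coordinates are i.i.d. with weights `p`. -/
noncomputable def iidE (p : Z → ℝ) (h : (ι → Z) → ℝ) : ℝ :=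
  ∑ z, (∏ i, p (z i)) * h z

lemma iidE_add (p : Z → ℝ) (g h : (ι → Z) → ℝ) :
    iidE p (fun z => g z + h z) = iidE p g + iidE p h := by
  simp [iidE, mul_add, Finset.sum_add_distrib]

lemma iidE_sub (p : Z → ℝ) (g h : (ι → Z) → ℝ) :
    iidE p (fun z => g z - h z) = iidE p g - iidE p h := by
  simp [iidE, mul_sub, Finset.sum_sub_distrib]

lemma iidE_const_mul (p : Z → ℝ) (c : ℝ) (h : (ι → Z) → ℝ) :
    iidE p (fun z => c * h z) = c * iidE p h := by
  simp only [iidE, Finset.mul_sum]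
  exact Finset.sum_congr rfl fun z _ => by ring

lemma iidE_sum {A : Type*} (p : Z → ℝ) (s : Finset A) (f : A → (ι → Z) → ℝ) :
    iidE p (fun z => ∑ a ∈ s, f a z) = ∑ a ∈ s, iidE p (f a) := by
  simp only [iidE, Finset.mul_sum]
  exact Finset.sum_comm

lemma iidE_const {p : Z → ℝ} (hp : ∑ w, p w = 1) (c : ℝ) :
    iidE p (fun _ : ι → Z => c) = c := by
  have h := Finset.prod_univ_sum (fun _ : ι => (Finset.univ : Finset Z)) (fun _ w => p w)
  rw [Fintype.piFinset_univ] at h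
  rw [iidE, ← Finset.sum_mul, ← h]
  simp [hp]

lemma iidE_mono {p : Z → ℝ} (hp : ∀ w, 0 ≤ p w) {g h : (ι → Z) → ℝ}
    (hgh : ∀ z, 0 < ∏ i, p (z i) → g z ≤ h z) : iidE p g ≤ iidE p h := by
  refine Finset.sum_le_sum fun z _ => ?_
  rcases (Finset.prod_nonneg fun i (_ : i ∈ Finset.univ) => hp (z i)).eq_or_lt with h0 | h0
  · simp [← h0]
  · exact mul_le_mul_of_nonneg_left (hgh z h0) h0.le

lemma iidE_nonneg {p : Z → ℝ} (hp : ∀ w, 0 ≤ p w) {h : (ι → Z) → ℝ} (hh : ∀ z, 0 ≤ h z) :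
    0 ≤ iidE p h :=
  Finset.sum_nonneg fun z _ => mul_nonneg (Finset.prod_nonneg fun i _ => hp (z i)) (hh z)

lemma iidE_avgAt {p : Z → ℝ} (hp : ∑ w, p w = 1) (k : ι) (h : (ι → Z) → ℝ) :
    iidE p (avgAt p k h) = iidE p h := by
  have hinv : Function.Involutive
      (fun a : (ι → Z) × Z => (Function.update a.1 k a.2, a.1 k)) := by
    rintro ⟨z, w⟩
    simp
  have hw : ∀ (z : ι → Z) (w : Z),
      (∏ i, p (Function.update z k w i)) * p (z k) = (∏ i, p (z i)) * p w := by
    intro z w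
    rw [← Finset.mul_prod_erase _ _ (Finset.mem_univ k),
      ← Finset.mul_prod_erase _ (fun i => p (z i)) (Finset.mem_univ k)]
    have : ∏ i ∈ Finset.univ.erase k, p (Function.update z k w i)
        = ∏ i ∈ Finset.univ.erase k, p (z i) :=
      Finset.prod_congr rfl fun i hi => by
        rw [Function.update_of_ne (Finset.ne_of_mem_erase hi)]
    rw [this, Function.update_self]
    ring
  calc iidE p (avgAt p k h)
      = ∑ a : (ι → Z) × Z, (∏ i, p (a.1 i)) * p a.2 * h (Function.update a.1 k a.2) := by
        rw [Fintype.sum_prod_type]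
        simp only [iidE, avgAt, Finset.mul_sum, mul_assoc]
    _ = ∑ a : (ι → Z) × Z, (∏ i, p (a.1 i)) * p a.2 * h a.1 := by
        refine Fintype.sum_equiv hinv.toPerm _ _ ?_
        rintro ⟨z, w⟩
        simp only [Function.Involutive.coe_toPerm]
        rw [hw]
    _ = iidE p h := by
        rw [Fintype.sum_prod_type, iidE]
        refine Finset.sum_congr rfl fun z _ => ?_
        simp only
        rw [← Finset.sum_mul, ← Finset.mul_sum, hp, mul_one]

lemma iidE_coord_mul {p : Z → ℝ} (hp : ∑ w, p w = 1) (k : ι) (a : Z → ℝ) (h : (ι → Z) → ℝ)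
    (hh : ∀ z w, h (Function.update z k w) = h z) :
    iidE p (fun z => a (z k) * h z) = (∑ w, p w * a w) * iidE p h := by
  rw [← iidE_avgAt hp k, ← iidE_const_mul]
  congr 1
  funext z
  rw [avgAt_mul k (fun z => a (z k)) h hh]
  simp [avgAt]

lemma iidE_coord {p : Z → ℝ} (hp : ∑ w, p w = 1) (k : ι) (a : Z → ℝ) :
    iidE p (fun z : ι → Z => a (z k)) = ∑ w, p w * a w := by
  have h := iidE_coord_mul hp k a (fun _ => 1) (fun _ _ => rfl)
  rw [iidE_const hp] at h
  simpa using h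

lemma iidE_sq_sub_avgAt {p : Z → ℝ} (hp : ∑ w, p w = 1) (k : ι) (h : (ι → Z) → ℝ) :
    iidE p (fun z => (h z - avgAt p k h z) ^ 2)
      = iidE p (fun z => h z ^ 2) - iidE p (fun z => avgAt p k h z ^ 2) := by
  have hcross : iidE p (fun z => h z * avgAt p k h z) = iidE p (fun z => avgAt p k h z ^ 2) := by
    rw [← iidE_avgAt hp k]
    congr 1
    funext z
    rw [avgAt_mul k h _ (avgAt_update p k h)]
    ring
  have hexp : (fun z => (h z - avgAt p k h z) ^ 2)
      = fun z => (h z ^ 2 - 2 * (h z * avgAt p k h z)) + avgAt p k h z ^ 2 := by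
    funext z
    ring
  rw [hexp, iidE_add, iidE_sub, iidE_const_mul, hcross]
  ring

/-- If at most `r` summands depend on any given coordinate, then the variance of the sum is at
most `r` times the sum of the variances. -/
lemma variance_sum_le {A : Type*} {p : Z → ℝ} (hp0 : ∀ w, 0 ≤ p w) (hp : ∑ w, p w = 1)
    (s : Finset A) (T : A → Finset ι) (r : ℝ)
    (hr : ∀ j, ((s.filter fun a => j ∈ T a).card : ℝ) ≤ r) (S : Finset ι) :
    ∀ f : A → (ι → Z) → ℝ, (∀ a ∈ s, DependsOn (f a) {j | j ∈ S ∧ j ∈ T a}) →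
      iidE p (fun z => (∑ a ∈ s, f a z) ^ 2) - (∑ a ∈ s, iidE p (f a)) ^ 2
        ≤ r * ∑ a ∈ s, (iidE p (fun z => f a z ^ 2) - iidE p (f a) ^ 2) := by
  induction S using Finset.induction_on with
  | empty =>
    intro f hf
    rcases isEmpty_or_nonempty (ι → Z) with hempty | ⟨⟨z0⟩⟩
    · simp [iidE]
    have hconst : ∀ a ∈ s, f a = fun _ => f a z0 := fun a ha => by
      funext z
      exact hf a ha (by simp)
    have h1 : ∀ a ∈ s, iidE p (f a) = f a z0 := fun a ha => by
      rw [hconst a ha, iidE_const hp]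
    have h2 : ∀ a ∈ s, iidE p (fun z => f a z ^ 2) = f a z0 ^ 2 := fun a ha => by
      rw [hconst a ha, iidE_const hp]
    have h3 : (fun z => (∑ a ∈ s, f a z) ^ 2) = fun _ => (∑ a ∈ s, f a z0) ^ 2 := by
      funext z
      rw [Finset.sum_congr rfl fun a ha => congrFun (hconst a ha) z]
    have h4 : ∀ a ∈ s, iidE p (fun z => f a z ^ 2) - iidE p (f a) ^ 2 = 0 := fun a ha => by
      rw [h1 a ha, h2 a ha, sub_self]
    rw [h3, iidE_const hp, Finset.sum_congr rfl h1, Finset.sum_eq_zero h4]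
    simp
  | insert k S hk ih =>
    intro f hf
    have hdep : ∀ a ∈ s, DependsOn (avgAt p k (f a)) {j | j ∈ S ∧ j ∈ T a} := by
      intro a ha x y hxy
      refine Finset.sum_congr rfl fun w _ => ?_
      rw [hf a ha (x := Function.update x k w) (y := Function.update y k w)]
      rintro i ⟨hi, hiT⟩
      rcases eq_or_ne i k with rfl | hik
      · simp
      · rw [Function.update_of_ne hik, Function.update_of_ne hik]
        exact hxy i ⟨(Finset.mem_insert.1 hi).resolve_left hik, hiT⟩
    have hIH := ih _ hdep
    have havg : ∀ z, avgAt p k (fun z => ∑ a ∈ s, f a z) z = ∑ a ∈ s, avgAt p k (f a) z := by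
      intro z
      simp only [avgAt, Finset.mul_sum]
      exact Finset.sum_comm
    have hzero : ∀ a ∈ s, k ∉ T a → ∀ z, f a z - avgAt p k (f a) z = 0 := by
      intro a ha hka z
      rw [avgAt_eq_self hp (dependsOn_update (hf a ha) fun h => hka h.2), sub_self]
    have hpt : ∀ z, ((∑ a ∈ s, f a z) - ∑ a ∈ s, avgAt p k (f a) z) ^ 2
        ≤ r * ∑ a ∈ s, (f a z - avgAt p k (f a) z) ^ 2 := by
      intro z
      have e1 : ∑ a ∈ s with k ∈ T a, (f a z - avgAt p k (f a) z)
          = ∑ a ∈ s, (f a z - avgAt p k (f a) z) :=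
        Finset.sum_filter_of_ne fun a ha hne => by
          by_contra hka
          exact hne (hzero a ha hka z)
      rw [← Finset.sum_sub_distrib, ← e1]
      calc _ ≤ ((s.filter fun a => k ∈ T a).card : ℝ)
            * ∑ a ∈ s with k ∈ T a, (f a z - avgAt p k (f a) z) ^ 2 := sq_sum_le_card_mul_sum_sq
        _ ≤ r * ∑ a ∈ s, (f a z - avgAt p k (f a) z) ^ 2 := by
          refine mul_le_mul (hr k) ?_ (Finset.sum_nonneg fun _ _ => sq_nonneg _)
            ((Nat.cast_nonneg _).trans (hr k))
          exact Finset.sum_le_sum_of_subset_of_nonneg (Finset.filter_subset _ _)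
            fun _ _ _ => sq_nonneg _
    have hstep := iidE_mono hp0 (fun z _ => hpt z)
    rw [iidE_const_mul, iidE_sum] at hstep
    have hsq := iidE_sq_sub_avgAt hp k (fun z => ∑ a ∈ s, f a z)
    simp only [havg] at hsq
    rw [hsq, Finset.sum_congr rfl fun a _ => iidE_sq_sub_avgAt hp k (f a)] at hstep
    simp only [iidE_avgAt hp, Finset.sum_sub_distrib] at hIH hstep ⊢
    linarith

/-- Chebyshev's inequality at the origin. -/
lemma chebyshev_nonpos {p : Z → ℝ} (hp0 : ∀ w, 0 ≤ p w) (hp : ∑ w, p w = 1)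
    (F : (ι → Z) → ℝ) (hF : 0 < iidE p F) :
    iidE p (fun z => if F z ≤ 0 then 1 else 0)
      ≤ (iidE p (fun z => F z ^ 2) - iidE p F ^ 2) / iidE p F ^ 2 := by
  set μ := iidE p F with hμ
  rw [le_div_iff₀ (by positivity), mul_comm, ← iidE_const_mul]
  have hvar : iidE p (fun z => F z ^ 2) - μ ^ 2 = iidE p (fun z => (F z - μ) ^ 2) := by
    have hexp : (fun z => (F z - μ) ^ 2) = fun z => (F z ^ 2 - 2 * μ * F z) + μ ^ 2 := by
      funext z
      ring
    rw [hexp, iidE_add, iidE_sub, iidE_const_mul, iidE_const hp, ← hμ]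
    ring
  rw [hvar]
  refine iidE_mono hp0 fun z _ => ?_
  split_ifs with h
  · nlinarith
  · rw [mul_zero]
    positivity

end IidExpectation

section SoftDecoding
open scoped Classical

/-- The sign `(-1) ^ b` of a bit `b`. -/
noncomputable def bitSign (b : ZMod 2) : ℝ := if b = 0 then 1 else -1

lemma zmod_two_cases (b : ZMod 2) : b = 0 ∨ b = 1 := by
  revert b
  decide

@[simp] lemma bitSign_zero : bitSign 0 = 1 := by simp [bitSign]

@[simp] lemma bitSign_one : bitSign 1 = -1 := by simp [bitSign]

lemma bitSign_add (a b : ZMod 2) : bitSign (a + b) = bitSign a * bitSign b := by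
  have h : (1 : ZMod 2) + 1 = 0 := by decide
  rcases zmod_two_cases a with rfl | rfl <;> rcases zmod_two_cases b with rfl | rfl <;> simp [h]

lemma abs_bitSign (b : ZMod 2) : |bitSign b| = 1 := by
  rcases zmod_two_cases b with rfl | rfl <;> simp

lemma indicator_ne_eq_bitSign (a b : ZMod 2) :
    (if a ≠ b then 1 else 0 : ℝ) = (1 - bitSign a * bitSign b) / 2 := by
  rcases zmod_two_cases a with rfl | rfl <;> rcases zmod_two_cases b with rfl | rfl <;> norm_num

lemma outputOf_involutive {ι E : Type*} (x : ι → ZMod 2) :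
    Function.Involutive (outputOf (E := E) x) := by
  intro z
  funext j
  simp [outputOf, ← add_assoc, CharTwo.add_self_eq_zero]

lemma outputOf_outputOf {ι E : Type*} (x y : ι → ZMod 2) (z : ι → E × ZMod 2) :
    outputOf x (outputOf y z) = outputOf (x + y) z := by
  funext j
  simp [outputOf, add_assoc]

lemma prod_outputOf_dependsOn {ι E : Type*} (p : E × ZMod 2 → ℝ) (S : Finset ι) (x : ι → ZMod 2) :
    DependsOn (fun z => ∏ j ∈ S, p (outputOf x z j)) (S : Set ι) := by
  intro y z hyz
  exact Finset.prod_congr rfl fun j hj => by simp only [outputOf, hyz j hj]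

variable {ι E : Type*} [Fintype ι]

variable (C : Submodule (ZMod 2) (ι → ZMod 2)) (p : E × ZMod 2 → ℝ)

/-- Probability that the outputs on `S` agree with `z`. -/
noncomputable def likelihood (S : Finset ι) (z : ι → E × ZMod 2) : ℝ :=
  (Nat.card C : ℝ)⁻¹ * ∑ x : C, ∏ j ∈ S, p (outputOf (x : ι → ZMod 2) z j)

/-- Expectation of the sign of bit `i` on the event that the outputs on `S` agree with `z`. -/
noncomputable def signedLikelihood (i : ι) (S : Finset ι) (z : ι → E × ZMod 2) : ℝ :=
  (Nat.card C : ℝ)⁻¹ *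
    ∑ x : C, bitSign ((x : ι → ZMod 2) i) * ∏ j ∈ S, p (outputOf (x : ι → ZMod 2) z j)

/-- Posterior mean of the sign of bit `i` given the outputs on `S`. -/
noncomputable def softBit (i : ι) (S : Finset ι) (z : ι → E × ZMod 2) : ℝ :=
  signedLikelihood C p i S z / likelihood C p S z

variable {C p}

lemma card_code_pos : 0 < (Nat.card C : ℝ) := Nat.cast_pos.2 Nat.card_pos

lemma card_code_eq : (Nat.card C : ℝ) = ∑ _x : C, (1 : ℝ) := by
  simp [Nat.card_eq_fintype_card]

lemma abs_signedLikelihood_le (hp0 : ∀ w, 0 ≤ p w) (i : ι) (S : Finset ι)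
    (z : ι → E × ZMod 2) : |signedLikelihood C p i S z| ≤ likelihood C p S z := by
  rw [signedLikelihood, likelihood, abs_mul, abs_of_pos (inv_pos.2 card_code_pos)]
  refine mul_le_mul_of_nonneg_left ?_ (inv_pos.2 card_code_pos).le
  refine (Finset.abs_sum_le_sum_abs _ _).trans (Finset.sum_le_sum fun x _ => ?_)
  rw [abs_mul, abs_bitSign, one_mul, abs_of_nonneg (Finset.prod_nonneg fun j _ => hp0 _)]

lemma likelihood_mul_softBit (hp0 : ∀ w, 0 ≤ p w) (i : ι) (S : Finset ι)
    (z : ι → E × ZMod 2) :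
    likelihood C p S z * softBit C p i S z = signedLikelihood C p i S z := by
  rcases eq_or_ne (likelihood C p S z) 0 with h | h
  · have h' := abs_signedLikelihood_le (C := C) hp0 i S z
    rw [h, abs_nonpos_iff] at h'
    rw [h, h', zero_mul]
  · rw [softBit, mul_div_cancel₀ _ h]

lemma abs_softBit_le (hp0 : ∀ w, 0 ≤ p w) (i : ι) (S : Finset ι) (z : ι → E × ZMod 2) :
    |softBit C p i S z| ≤ 1 := by
  have h := abs_signedLikelihood_le (C := C) hp0 i S z
  rw [softBit, abs_div, abs_of_nonneg ((abs_nonneg _).trans h)]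
  exact div_le_one_of_le₀ h ((abs_nonneg _).trans h)

lemma softBit_dependsOn (i : ι) (S : Finset ι) : DependsOn (softBit C p i S) (S : Set ι) := by
  intro y z hyz
  simp only [softBit, signedLikelihood, likelihood,
    fun x : ι → ZMod 2 => prod_outputOf_dependsOn p S x hyz]

lemma softBit_outputOf (i : ι) (S : Finset ι) (c : C) (z : ι → E × ZMod 2) :
    softBit C p i S (outputOf (c : ι → ZMod 2) z)
      = bitSign ((c : ι → ZMod 2) i) * softBit C p i S z := by
  have hL : likelihood C p S (outputOf (c : ι → ZMod 2) z) = likelihood C p S z := by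
    simp only [likelihood, outputOf_outputOf]
    congr 1
    exact Fintype.sum_equiv (Equiv.addRight c) _ _ fun x => rfl
  have hM : signedLikelihood C p i S (outputOf (c : ι → ZMod 2) z)
      = bitSign ((c : ι → ZMod 2) i) * signedLikelihood C p i S z := by
    simp only [signedLikelihood, outputOf_outputOf]
    rw [mul_left_comm]
    congr 1
    rw [Finset.mul_sum]
    refine Fintype.sum_equiv (Equiv.addRight c) _ _ fun x => ?_
    have hs : bitSign ((x : ι → ZMod 2) i)
        = bitSign ((c : ι → ZMod 2) i) * bitSign (((x + c : C) : ι → ZMod 2) i) := by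
      rw [← bitSign_add]
      congr 1
      simp only [Submodule.coe_add, Pi.add_apply]
      rw [add_left_comm, CharTwo.add_self_eq_zero, add_zero]
    rw [hs, mul_assoc]
    rfl
  rw [softBit, softBit, hL, hM, mul_div_assoc]

lemma softBit_image {σ : Equiv.Perm ι} (hσ : ∀ x ∈ C, x ∘ σ ∈ C) (i : ι) (S : Finset ι)
    (z : ι → E × ZMod 2) :
    softBit C p (σ i) (S.image σ) z = softBit C p i S (z ∘ σ) := by
  let φ : C → C := fun x => ⟨(x : ι → ZMod 2) ∘ σ, hσ x x.2⟩
  have hφ : Function.Bijective φ := by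
    refine Finite.injective_iff_bijective.1 fun x y hxy => Subtype.ext ?_
    exact σ.surjective.injective_comp_right (congrArg Subtype.val hxy)
  have hprod : ∀ x : C, ∏ j ∈ S.image σ, p (outputOf (x : ι → ZMod 2) z j)
      = ∏ j ∈ S, p (outputOf (φ x : ι → ZMod 2) (z ∘ σ) j) := by
    intro x
    rw [Finset.prod_image σ.injective.injOn]
    rfl
  have hM : signedLikelihood C p (σ i) (S.image σ) z = signedLikelihood C p i S (z ∘ σ) := by
    simp only [signedLikelihood, hprod]
    congr 1
    exact Fintype.sum_bijective φ hφ _ _ fun x => rfl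
  have hL : likelihood C p (S.image σ) z = likelihood C p S (z ∘ σ) := by
    simp only [likelihood, hprod]
    congr 1
    exact Fintype.sum_bijective φ hφ _ _ fun x => rfl
  rw [softBit, softBit, hM, hL]

variable [Fintype E]

lemma iidE_shift (p : E × ZMod 2 → ℝ) (S : Finset ι) (x : ι → ZMod 2)
    {g : (ι → E × ZMod 2) → ℝ} (hg : DependsOn g (S : Set ι)) :
    iidE p g = ∑ z, (∏ j ∈ Sᶜ, p (z j)) *
      ((∏ j ∈ S, p (outputOf x z j)) * g (outputOf x z)) := by
  let x' : ι → ZMod 2 := fun j => if j ∈ S then x j else 0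
  have hS : ∀ z : ι → E × ZMod 2, ∀ j ∈ S, outputOf x' z j = outputOf x z j := by
    intro z j hj
    simp [outputOf, x', hj]
  have hSc : ∀ z : ι → E × ZMod 2, ∀ j ∈ Sᶜ, outputOf x' z j = z j := by
    intro z j hj
    simp [outputOf, x', Finset.mem_compl.1 hj]
  rw [iidE, ← Equiv.sum_comp (outputOf_involutive x').toPerm]
  refine Finset.sum_congr rfl fun z _ => ?_
  simp only [Function.Involutive.coe_toPerm]
  rw [← Finset.prod_mul_prod_compl S, Finset.prod_congr rfl fun j hj => by rw [hS z j hj],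
    Finset.prod_congr (s₁ := Sᶜ) rfl fun j hj => by rw [hSc z j hj],
    hg (x := outputOf x' z) (y := outputOf x z) (fun j hj => hS z j hj)]
  ring

lemma iidE_eq_average (S : Finset ι) {g : (ι → E × ZMod 2) → ℝ}
    (hg : DependsOn g (S : Set ι)) :
    iidE p g = ∑ z, (∏ j ∈ Sᶜ, p (z j)) * ((Nat.card C : ℝ)⁻¹ * ∑ x : C,
      (∏ j ∈ S, p (outputOf (x : ι → ZMod 2) z j)) * g (outputOf (x : ι → ZMod 2) z)) := by
  have h : (Nat.card C : ℝ) * iidE p g = ∑ x : C, iidE p g := by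
    rw [card_code_eq, Finset.sum_mul]
    simp
  rw [← inv_mul_cancel_left₀ (card_code_pos (C := C)).ne' (iidE p g), h,
    Finset.sum_congr rfl fun (x : C) _ => iidE_shift p S (x : ι → ZMod 2) hg, Finset.sum_comm,
    Finset.mul_sum]
  refine Finset.sum_congr rfl fun z _ => ?_
  rw [← Finset.mul_sum]
  ring

/-- The posterior mean is the orthogonal projection of the sign of bit `i`. -/
lemma iidE_softBit_mul (hp0 : ∀ w, 0 ≤ p w) (i : ι) (S : Finset ι)
    {g : (ι → E × ZMod 2) → ℝ} (hg : DependsOn g (S : Set ι))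
    (hcov : ∀ (c : C) z, g (outputOf (c : ι → ZMod 2) z) = bitSign ((c : ι → ZMod 2) i) * g z) :
    iidE p (fun z => softBit C p i S z * g z) = iidE p g := by
  have hfg : DependsOn (fun z => softBit C p i S z * g z) (S : Set ι) := by
    intro y z hyz
    simp only [softBit_dependsOn i S hyz, hg hyz]
  rw [iidE_eq_average (C := C) S hg, iidE_eq_average (C := C) S hfg]
  refine Finset.sum_congr rfl fun z _ => ?_
  congr 1
  have h1 : ∀ x : C, softBit C p i S (outputOf (x : ι → ZMod 2) z)
      * g (outputOf (x : ι → ZMod 2) z) = softBit C p i S z * g z := by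
    intro x
    rw [softBit_outputOf, hcov]
    have := abs_mul_abs_self (bitSign ((x : ι → ZMod 2) i))
    rw [abs_bitSign] at this
    linear_combination (-(softBit C p i S z * g z)) * this
  simp only [h1]
  simp only [hcov]
  calc _ = (likelihood C p S z * softBit C p i S z) * g z := by
        rw [← Finset.sum_mul, likelihood]
        ring
    _ = _ := by
        rw [likelihood_mul_softBit hp0, signedLikelihood, mul_assoc, Finset.sum_mul]
        congr 1
        exact Finset.sum_congr rfl fun x _ => by ring

lemma iidE_softBit_sq (hp0 : ∀ w, 0 ≤ p w) (i : ι) (S : Finset ι) :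
    iidE p (fun z => softBit C p i S z ^ 2) = iidE p (softBit C p i S) := by
  simp only [sq]
  exact iidE_softBit_mul hp0 i S (softBit_dependsOn i S) (softBit_outputOf i S)

lemma iidE_softBit_nonneg (hp0 : ∀ w, 0 ≤ p w) (i : ι) (S : Finset ι) :
    0 ≤ iidE p (softBit C p i S) := by
  rw [← iidE_softBit_sq hp0]
  exact iidE_nonneg hp0 fun z => sq_nonneg _

lemma iidE_softBit_mono (hp0 : ∀ w, 0 ≤ p w) (i : ι) {S T : Finset ι} (hST : S ⊆ T) :
    iidE p (softBit C p i S) ≤ iidE p (softBit C p i T) := by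
  have hcross := iidE_softBit_mul hp0 i T
    ((softBit_dependsOn (C := C) (p := p) i S).mono (by exact_mod_cast hST)) (softBit_outputOf i S)
  have hsq : 0 ≤ iidE p (fun z => (softBit C p i T z - softBit C p i S z) ^ 2) :=
    iidE_nonneg hp0 fun z => sq_nonneg _
  have hexp : (fun z => (softBit C p i T z - softBit C p i S z) ^ 2) = fun z =>
      (softBit C p i T z ^ 2 - 2 * (softBit C p i T z * softBit C p i S z))
        + softBit C p i S z ^ 2 := by
    funext z
    ring
  rw [hexp, iidE_add, iidE_sub, iidE_const_mul, hcross, iidE_softBit_sq hp0,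
    iidE_softBit_sq hp0] at hsq
  linarith

lemma iidE_comp_perm {Z : Type*} [Fintype Z] (p : Z → ℝ) (σ : Equiv.Perm ι)
    (h : (ι → Z) → ℝ) : iidE p (fun z => h (z ∘ σ)) = iidE p h := by
  refine Fintype.sum_equiv (Equiv.arrowCongr σ.symm (Equiv.refl Z)) _ _ fun z => ?_
  have : Equiv.arrowCongr σ.symm (Equiv.refl Z) z = z ∘ σ := by
    funext j
    simp
  rw [this]
  congr 1
  exact (Equiv.prod_comp σ fun i => p (z i)).symm

lemma iidE_softBit_image {σ : Equiv.Perm ι} (hσ : ∀ x ∈ C, x ∘ σ ∈ C) (i : ι) (S : Finset ι) :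
    iidE p (softBit C p (σ i) (S.image σ)) = iidE p (softBit C p i S) := by
  rw [← iidE_comp_perm p σ (softBit C p i S)]
  congr 1
  funext z
  exact softBit_image hσ i S z

end SoftDecoding

section Channel
open scoped Classical

variable {ι E : Type*} [Fintype E] {q eps : E → ℝ}

lemma noiseP_nonneg (hch : ChannelValid q eps) (w : E × ZMod 2) : 0 ≤ noiseP q eps w := by
  obtain ⟨hq, -, he⟩ := hch
  refine mul_nonneg (hq _) ?_
  split_ifs <;> linarith [(he w.1).1, (he w.1).2]

lemma sum_bit (f : ZMod 2 → ℝ) : ∑ b, f b = f 0 + f 1 := Fin.sum_univ_two f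

lemma sum_noiseP (hch : ChannelValid q eps) : ∑ w, noiseP q eps w = 1 := by
  rw [Fintype.sum_prod_type, ← hch.2.1]
  refine Finset.sum_congr rfl fun e _ => ?_
  rw [sum_bit]
  simp [noiseP]
  ring

lemma noiseP_eq {E : Type*} (q eps : E → ℝ) (w : E × ZMod 2) :
    noiseP q eps w = q w.1 / 2 * (1 + (1 - 2 * eps w.1) * bitSign w.2) := by
  obtain ⟨e, b⟩ := w
  rcases zmod_two_cases b with rfl | rfl <;> simp [noiseP] <;> ring

lemma sum_noiseP_mul_bias (hch : ChannelValid q eps) :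
    ∑ w, noiseP q eps w * ((1 - 2 * eps w.1) * bitSign w.2) ≤ 1 := by
  rw [Fintype.sum_prod_type]
  refine (Finset.sum_le_sum fun e _ => ?_).trans_eq hch.2.1
  rw [sum_bit]
  simp only [noiseP_eq, bitSign_zero, bitSign_one]
  obtain ⟨h0, h1⟩ := hch.2.2 e
  have : (1 - 2 * eps e) ^ 2 ≤ 1 := by nlinarith
  nlinarith [mul_le_mul_of_nonneg_left this (hch.1 e)]

lemma mul_log_two_mul (t : ℝ) : t * Real.log (2 * t) = t * Real.log 2 + t * Real.log t := by
  rcases eq_or_ne t 0 with rfl | h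
  · simp
  · rw [Real.log_mul two_ne_zero h, mul_add]

lemma sum_noiseP_mul_log (q eps : E → ℝ) :
    ∑ w, noiseP q eps w * Real.log (noiseP q eps w / (q w.1 / 2))
      = Real.log 2 * capacity q eps := by
  rw [Fintype.sum_prod_type, capacity, Finset.mul_sum]
  refine Finset.sum_congr rfl fun e _ => ?_
  rw [sum_bit]
  rcases eq_or_ne (q e) 0 with h | h
  · simp [noiseP, h]
  have hr : ∀ t : ℝ, q e * t / (q e / 2) = 2 * t := fun t => by field_simp
  have hl : Real.log 2 ≠ 0 := (Real.log_pos one_lt_two).ne'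
  simp only [noiseP, zero_ne_one, if_false, if_true, hr, mul_assoc, mul_log_two_mul, binEnt,
    Real.logb]
  field_simp
  ring

variable [Fintype ι] {C : Submodule (ZMod 2) (ι → ZMod 2)}

lemma likelihood_insert {E : Type*} (q eps : E → ℝ) {i : ι} {S : Finset ι} (hi : i ∉ S)
    (z : ι → E × ZMod 2) :
    likelihood C (noiseP q eps) (insert i S) z = q (z i).1 / 2 *
      (likelihood C (noiseP q eps) S z + (1 - 2 * eps (z i).1) * bitSign (z i).2 *
        signedLikelihood C (noiseP q eps) i S z) := by
  simp only [likelihood, signedLikelihood, Finset.prod_insert hi]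
  rw [mul_left_comm _ (Nat.card C : ℝ)⁻¹, ← mul_add, mul_left_comm]
  congr 1
  rw [Finset.mul_sum, ← Finset.sum_add_distrib, Finset.mul_sum]
  refine Finset.sum_congr rfl fun x _ => ?_
  rw [noiseP_eq q eps (outputOf _ z i)]
  simp only [outputOf, bitSign_add]
  ring

/-- The code restricted to `S` has `2 ^ k` words, each of which has as many preimages. -/
lemma prod_le_likelihood {E : Type*} {p : E × ZMod 2 → ℝ} (hp0 : ∀ w, 0 ≤ p w) (S : Finset ι)
    (z : ι → E × ZMod 2) :
    ((2 : ℝ) ^ Module.finrank (ZMod 2)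
      (C.map (LinearMap.funLeft (ZMod 2) (ZMod 2) (fun s : S => (s : ι)))))⁻¹ * ∏ j ∈ S, p (z j)
      ≤ likelihood C p S z := by
  set φ := (LinearMap.funLeft (ZMod 2) (ZMod 2) (fun s : S => (s : ι))) ∘ₗ C.subtype with hφ
  have hrange : LinearMap.range φ
      = C.map (LinearMap.funLeft (ZMod 2) (ZMod 2) (fun s : S => (s : ι))) := by
    rw [hφ, LinearMap.range_comp, Submodule.range_subtype]
  have hcard : (Nat.card C : ℝ) = (2 : ℝ) ^ Module.finrank (ZMod 2) (LinearMap.range φ)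
      * Nat.card (LinearMap.ker φ) := by
    rw [Module.natCard_eq_pow_finrank (K := ZMod 2) (V := C),
      Module.natCard_eq_pow_finrank (K := ZMod 2) (V := LinearMap.ker φ),
      ← LinearMap.finrank_range_add_finrank_ker φ]
    simp [pow_add]
  have hker : (0 : ℝ) < Nat.card (LinearMap.ker φ) := Nat.cast_pos.2 Nat.card_pos
  have hword : ∀ x ∈ Finset.univ.filter (fun x : C => x ∈ LinearMap.ker φ),
      ∏ j ∈ S, p (outputOf (x : ι → ZMod 2) z j) = ∏ j ∈ S, p (z j) := by
    intro x hx
    have hx0 : φ x = 0 := LinearMap.mem_ker.1 (Finset.mem_filter.1 hx).2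
    refine Finset.prod_congr rfl fun j hj => ?_
    have : (x : ι → ZMod 2) j = 0 := congrFun hx0 ⟨j, hj⟩
    simp [outputOf, this]
  have hcount : ((Finset.univ.filter (fun x : C => x ∈ LinearMap.ker φ)).card : ℝ)
      = Nat.card (LinearMap.ker φ) := by
    rw [Nat.card_eq_fintype_card, Fintype.card_subtype]
  calc _ = (Nat.card C : ℝ)⁻¹ * ∑ x : C with x ∈ LinearMap.ker φ,
        ∏ j ∈ S, p (outputOf (x : ι → ZMod 2) z j) := by
        rw [Finset.sum_congr rfl hword, Finset.sum_const, nsmul_eq_mul, hcount, hcard, hrange]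
        field_simp
    _ ≤ _ := by
        refine mul_le_mul_of_nonneg_left ?_ (inv_pos.2 card_code_pos).le
        exact Finset.sum_le_sum_of_subset_of_nonneg (Finset.filter_subset _ _)
          fun x _ _ => Finset.prod_nonneg fun j _ => hp0 _

/-- Logarithm of the density of the output on `S` relative to a uniform input. -/
noncomputable def logDensity (C : Submodule (ZMod 2) (ι → ZMod 2)) (q eps : E → ℝ)
    (S : Finset ι) (z : ι → E × ZMod 2) : ℝ :=
  Real.log (likelihood C (noiseP q eps) S z / ∏ j ∈ S, (q (z j).1 / 2))

lemma noiseP_pos_of_prod_pos (hch : ChannelValid q eps) {z : ι → E × ZMod 2}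
    (hz : 0 < ∏ i, noiseP q eps (z i)) (i : ι) :
    0 < noiseP q eps (z i) ∧ 0 < q (z i).1 := by
  have h : noiseP q eps (z i) ≠ 0 := Finset.prod_ne_zero_iff.1 hz.ne' i (Finset.mem_univ i)
  exact ⟨(noiseP_nonneg hch _).lt_of_ne' h, (hch.1 _).lt_of_ne' (left_ne_zero_of_mul h)⟩

lemma likelihood_pos (hch : ChannelValid q eps) {z : ι → E × ZMod 2}
    (hz : 0 < ∏ i, noiseP q eps (z i)) (S : Finset ι) :
    0 < likelihood C (noiseP q eps) S z := by
  refine lt_of_lt_of_le (mul_pos (by positivity) ?_) (prod_le_likelihood (noiseP_nonneg hch) S z)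
  exact Finset.prod_pos fun j _ => (noiseP_pos_of_prod_pos hch hz j).1

lemma logDensity_insert_le (hch : ChannelValid q eps) {z : ι → E × ZMod 2}
    (hz : 0 < ∏ i, noiseP q eps (z i)) {i : ι} {S : Finset ι} (hi : i ∉ S) :
    logDensity C q eps (insert i S) z ≤ logDensity C q eps S z +
      (1 - 2 * eps (z i).1) * bitSign (z i).2 * softBit C (noiseP q eps) i S z := by
  have hq := (noiseP_pos_of_prod_pos hch hz i).2
  have hL := likelihood_pos (C := C) hch hz S
  have hLi := likelihood_pos (C := C) hch hz (insert i S)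
  have hU : 0 < ∏ j ∈ S, (q (z j).1 / 2) :=
    Finset.prod_pos fun j _ => half_pos (noiseP_pos_of_prod_pos hch hz j).2
  set t := (1 - 2 * eps (z i).1) * bitSign (z i).2 * softBit C (noiseP q eps) i S z with ht
  have hfac : likelihood C (noiseP q eps) (insert i S) z
      = q (z i).1 / 2 * (likelihood C (noiseP q eps) S z * (1 + t)) := by
    rw [likelihood_insert q eps hi, ← likelihood_mul_softBit (noiseP_nonneg hch), ht]
    ring
  have ht0 : 0 < 1 + t := by
    rw [hfac] at hLi
    exact pos_of_mul_pos_right (pos_of_mul_pos_right hLi (by positivity)) hL.le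
  have hquot : likelihood C (noiseP q eps) (insert i S) z / ∏ j ∈ insert i S, (q (z j).1 / 2)
      = likelihood C (noiseP q eps) S z / (∏ j ∈ S, (q (z j).1 / 2)) * (1 + t) := by
    rw [hfac, Finset.prod_insert hi]
    field_simp
  rw [logDensity, hquot, Real.log_mul (div_pos hL hU).ne' ht0.ne', logDensity]
  linarith [Real.log_le_sub_one_of_pos ht0]

lemma iidE_logDensity_le (hch : ChannelValid q eps) (P : Finset ι) (S : Finset ι) (hS : S ⊆ P) :
    iidE (noiseP q eps) (logDensity C q eps S)
      ≤ ∑ i ∈ S, iidE (noiseP q eps) (softBit C (noiseP q eps) i (P.erase i)) := by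
  have hp0 := noiseP_nonneg hch
  have hp1 := sum_noiseP hch
  induction S using Finset.induction_on with
  | empty =>
    have : logDensity C q eps ∅ = fun _ => 0 := by
      funext z
      have hc : ∑ _x : C, (1 : ℝ) = Nat.card C := card_code_eq.symm
      simp only [logDensity, likelihood, Finset.prod_empty, hc]
      simp
    rw [this, iidE_const hp1]
    simp
  | insert i S hi ih =>
    have hstep := iidE_mono hp0 fun z hz => logDensity_insert_le (C := C) hch hz hi
    rw [iidE_add, iidE_coord_mul hp1 i (fun w => (1 - 2 * eps w.1) * bitSign w.2) _
      (dependsOn_update (softBit_dependsOn i S) (by exact_mod_cast hi))] at hstep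
    have h1 := mul_le_mul_of_nonneg_right (sum_noiseP_mul_bias hch)
      (iidE_softBit_nonneg (C := C) hp0 i S)
    have h2 : iidE (noiseP q eps) (softBit C (noiseP q eps) i S)
        ≤ iidE (noiseP q eps) (softBit C (noiseP q eps) i (P.erase i)) :=
      iidE_softBit_mono hp0 i fun j hj => Finset.mem_erase.2
        ⟨ne_of_mem_of_not_mem hj hi, hS (Finset.mem_insert_of_mem hj)⟩
    rw [Finset.sum_insert hi]
    linarith [ih fun j hj => hS (Finset.mem_insert_of_mem hj)]

lemma le_iidE_logDensity (hch : ChannelValid q eps) (P : Finset ι) :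
    Real.log 2 * (P.card * capacity q eps - Module.finrank (ZMod 2)
      (C.map (LinearMap.funLeft (ZMod 2) (ZMod 2) (fun s : P => (s : ι)))))
      ≤ iidE (noiseP q eps) (logDensity C q eps P) := by
  have hp0 := noiseP_nonneg hch
  have hp1 := sum_noiseP hch
  set k := Module.finrank (ZMod 2)
    (C.map (LinearMap.funLeft (ZMod 2) (ZMod 2) (fun s : P => (s : ι)))) with hk
  calc _ = iidE (noiseP q eps) (fun z : ι → E × ZMod 2 =>
        (∑ j ∈ P, Real.log (noiseP q eps (z j) / (q (z j).1 / 2))) - k * Real.log 2) := by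
        rw [iidE_sub, iidE_const hp1, iidE_sum, Finset.sum_congr rfl fun j _ =>
          iidE_coord hp1 j fun w => Real.log (noiseP q eps w / (q w.1 / 2))]
        rw [sum_noiseP_mul_log, Finset.sum_const, nsmul_eq_mul]
        ring
    _ ≤ _ := by
        refine iidE_mono hp0 fun z hz => ?_
        have hpos := noiseP_pos_of_prod_pos hch hz
        have hU : 0 < ∏ j ∈ P, (q (z j).1 / 2) :=
          Finset.prod_pos fun j _ => half_pos (hpos j).2
        have hN : 0 < ∏ j ∈ P, noiseP q eps (z j) := Finset.prod_pos fun j _ => (hpos j).1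
        rw [← Real.log_prod fun j _ => (div_pos (hpos j).1 (half_pos (hpos j).2)).ne',
          ← Real.log_pow, ← Real.log_div (by
            exact (Finset.prod_pos fun j _ => div_pos (hpos j).1 (half_pos (hpos j).2)).ne')
            (by positivity), Finset.prod_div_distrib, logDensity]
        refine Real.log_le_log (by positivity) ?_
        rw [div_right_comm]
        gcongr
        rw [div_eq_inv_mul]
        exact prod_le_likelihood hp0 P z

/-- Below capacity, the average bit of a code is softly decodable from the other outputs. -/
lemma sum_iidE_softBit_ge (hch : ChannelValid q eps) {γ : ℝ} (P : Finset ι)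
    (hrate : restrRate C P ≤ capacity q eps - γ) :
    γ * Real.log 2 * P.card
      ≤ ∑ i ∈ P, iidE (noiseP q eps) (softBit C (noiseP q eps) i (P.erase i)) := by
  rcases P.eq_empty_or_nonempty with rfl | hP
  · simp
  refine le_trans ?_ ((le_iidE_logDensity (C := C) hch P).trans
    (iidE_logDensity_le hch P P (Finset.Subset.refl P)))
  have hcard : (0 : ℝ) < P.card := Nat.cast_pos.2 hP.card_pos
  rw [restrRate, div_le_iff₀ hcard] at hrate
  nlinarith [Real.log_pos one_lt_two]

end Channel

section MapDecoding
open scoped Classical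

variable {ι E : Type*} [Fintype ι] [Fintype E] {q eps : E → ℝ}
  {C : Submodule (ZMod 2) (ι → ZMod 2)}

/-- Error probability of an arbitrary decoder `D` of bit `i`. -/
noncomputable def decoderErr (C : Submodule (ZMod 2) (ι → ZMod 2)) (q eps : E → ℝ) (i : ι)
    (D : (ι → E × ZMod 2) → ZMod 2) : ℝ :=
  (Nat.card C : ℝ)⁻¹ * ∑ x : C, iidE (noiseP q eps) fun z =>
    if D (outputOf (x : ι → ZMod 2) z) ≠ (x : ι → ZMod 2) i then 1 else 0

lemma errP_eq_decoderErr (i : ι) (S : Finset ι) :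
    errP C q eps i S = decoderErr C q eps i (decodeBit C q eps i S) := by
  rw [errP, decoderErr, Fintype.sum_prod_type, Finset.mul_sum]
  refine Finset.sum_congr rfl fun x _ => ?_
  rw [iidE, Finset.mul_sum]
  refine Finset.sum_congr rfl fun z _ => ?_
  simp only [jointP]
  split_ifs <;> simp

lemma decoderErr_eq (i : ι) (S : Finset ι) {D : (ι → E × ZMod 2) → ZMod 2}
    (hD : DependsOn D (S : Set ι)) :
    decoderErr C q eps i D = ∑ z, (∏ j ∈ Sᶜ, noiseP q eps (z j)) *
      ((likelihood C (noiseP q eps) S z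
        - bitSign (D z) * signedLikelihood C (noiseP q eps) i S z) / 2) := by
  have hx : ∀ x : C, (iidE (noiseP q eps) fun z =>
      if D (outputOf (x : ι → ZMod 2) z) ≠ (x : ι → ZMod 2) i then (1 : ℝ) else 0)
      = ∑ z, (∏ j ∈ Sᶜ, noiseP q eps (z j)) *
        ((∏ j ∈ S, noiseP q eps (outputOf (x : ι → ZMod 2) z j)) *
          ((1 - bitSign (D z) * bitSign ((x : ι → ZMod 2) i)) / 2)) := by
    intro x
    rw [iidE_shift _ S (x : ι → ZMod 2)]
    · refine Finset.sum_congr rfl fun z _ => ?_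
      simp only [outputOf_involutive (x : ι → ZMod 2) z]
      rw [indicator_ne_eq_bitSign]
    · intro y z hyz
      have : D (outputOf (x : ι → ZMod 2) y) = D (outputOf (x : ι → ZMod 2) z) :=
        hD fun j hj => by simp only [outputOf, hyz j hj]
      simp only [this]
  rw [decoderErr, Finset.sum_congr rfl fun x _ => hx x, Finset.sum_comm, Finset.mul_sum]
  refine Finset.sum_congr rfl fun z _ => ?_
  rw [← Finset.mul_sum, mul_left_comm]
  congr 1
  rw [likelihood, signedLikelihood, mul_left_comm, ← mul_sub, mul_div_assoc]
  congr 1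
  rw [Finset.mul_sum, ← Finset.sum_sub_distrib, Finset.sum_div]
  exact Finset.sum_congr rfl fun x _ => by ring

lemma sum_prod_agree {p : E × ZMod 2 → ℝ} (hp1 : ∑ w, p w = 1) (S : Finset ι)
    (x : ι → ZMod 2) (y : ι → E × ZMod 2) :
    ∑ z : ι → E × ZMod 2, (if ∀ j ∈ S, outputOf x z j = y j then ∏ j, p (z j) else 0)
      = ∏ j ∈ S, p (outputOf x y j) := by
  have hiff : ∀ (z : ι → E × ZMod 2) (j : ι), outputOf x z j = y j ↔ z j = outputOf x y j := by
    intro z j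
    have hz : outputOf x (outputOf x z) j = z j := congrFun (outputOf_involutive x z) j
    have hy : outputOf x (outputOf x y) j = y j := congrFun (outputOf_involutive x y) j
    constructor
    · intro h
      rw [← hz]
      simp only [outputOf] at h ⊢
      rw [← h]
    · intro h
      rw [← hy]
      simp only [outputOf] at h ⊢
      rw [h]
  have h := Finset.prod_univ_sum (fun _ : ι => (Finset.univ : Finset (E × ZMod 2)))
    (fun j w => if j ∈ S → w = outputOf x y j then p w else 0)
  rw [Fintype.piFinset_univ] at h
  simp only [hiff]
  calc _ = ∑ z : ι → E × ZMod 2, ∏ j, (if j ∈ S → z j = outputOf x y j then p (z j) else 0) := by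
        refine Finset.sum_congr rfl fun z _ => ?_
        rw [Fintype.prod_ite_zero]
    _ = ∏ j, if j ∈ S then p (outputOf x y j) else 1 := by
        rw [← h]
        refine Finset.prod_congr rfl fun j _ => ?_
        by_cases hj : j ∈ S <;> simp [hj, hp1]
    _ = _ := by simp

lemma post_eq (hp1 : ∑ w, noiseP q eps w = 1) (i : ι) (S : Finset ι) (b : ZMod 2)
    (y : ι → E × ZMod 2) :
    post C q eps i S b y = (Nat.card C : ℝ)⁻¹ * ∑ x : C, if (x : ι → ZMod 2) i = b then
      ∏ j ∈ S, noiseP q eps (outputOf (x : ι → ZMod 2) y j) else 0 := by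
  rw [post, Fintype.sum_prod_type, Finset.mul_sum]
  refine Finset.sum_congr rfl fun x _ => ?_
  by_cases hx : (x : ι → ZMod 2) i = b
  · simp only [hx, true_and, if_true, jointP]
    rw [← sum_prod_agree hp1, Finset.mul_sum]
    refine Finset.sum_congr rfl fun z _ => ?_
    rw [mul_ite, mul_zero]
  · simp [hx]

lemma post_zero_sub_post_one (hp1 : ∑ w, noiseP q eps w = 1) (i : ι) (S : Finset ι)
    (y : ι → E × ZMod 2) :
    post C q eps i S 0 y - post C q eps i S 1 y
      = signedLikelihood C (noiseP q eps) i S y := by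
  rw [post_eq hp1, post_eq hp1, signedLikelihood, ← mul_sub, ← Finset.sum_sub_distrib]
  congr 1
  refine Finset.sum_congr rfl fun x _ => ?_
  rcases zmod_two_cases ((x : ι → ZMod 2) i) with h | h <;> simp [h]

/-- MAP decoding is optimal. -/
lemma errP_le_decoderErr (hch : ChannelValid q eps) (i : ι) (S : Finset ι)
    {D : (ι → E × ZMod 2) → ZMod 2} (hD : DependsOn D (S : Set ι)) :
    errP C q eps i S ≤ decoderErr C q eps i D := by
  have hp1 := sum_noiseP hch
  have hdec : DependsOn (decodeBit C q eps i S) (S : Set ι) := by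
    intro y z hyz
    simp only [decodeBit, post_eq hp1,
      fun x : ι → ZMod 2 => prod_outputOf_dependsOn (noiseP q eps) S x hyz]
  rw [errP_eq_decoderErr, decoderErr_eq i S hdec, decoderErr_eq i S hD]
  refine Finset.sum_le_sum fun z _ => ?_
  refine mul_le_mul_of_nonneg_left ?_ (Finset.prod_nonneg fun j _ => noiseP_nonneg hch _)
  have hmax : bitSign (D z) * signedLikelihood C (noiseP q eps) i S z
      ≤ bitSign (decodeBit C q eps i S z) * signedLikelihood C (noiseP q eps) i S z := by
    have h := post_zero_sub_post_one (C := C) hp1 i S z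
    rw [decodeBit]
    split_ifs with hlt <;> rcases zmod_two_cases (D z) with hz | hz <;> simp only [hz,
      bitSign_zero, bitSign_one] <;> linarith
  linarith

/-- A score that transforms like bit `i` decodes it unless it is nonpositive on the noise. -/
lemma errP_le_iidE_nonpos (hch : ChannelValid q eps) (i : ι) (S : Finset ι)
    {F : (ι → E × ZMod 2) → ℝ} (hF : DependsOn F (S : Set ι))
    (hcov : ∀ (c : C) z, F (outputOf (c : ι → ZMod 2) z) = bitSign ((c : ι → ZMod 2) i) * F z) :
    errP C q eps i S ≤ iidE (noiseP q eps) (fun z => if F z ≤ 0 then 1 else 0) := by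
  have hD : DependsOn (fun z => if F z ≤ 0 then (1 : ZMod 2) else 0) (S : Set ι) := by
    intro y z hyz
    simp only [hF hyz]
  refine (errP_le_decoderErr hch i S hD).trans ?_
  rw [decoderErr, inv_mul_le_iff₀ card_code_pos, card_code_eq, Finset.sum_mul]
  refine Finset.sum_le_sum fun x _ => ?_
  rw [one_mul]
  refine iidE_mono (noiseP_nonneg hch) fun z _ => ?_
  rw [hcov]
  by_cases hz : F z ≤ 0
  · rw [if_pos hz]
    split_ifs <;> norm_num
  · push Not at hz
    rcases zmod_two_cases ((x : ι → ZMod 2) i) with h | h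
    · simp [h, hz.not_ge]
    · simp [h, hz.le, hz.not_ge]

end MapDecoding

section Camellia
open scoped Classical

variable {ι : Type*} {C : Submodule (ZMod 2) (ι → ZMod 2)}

/-- The sum over the petals through `i` of any symmetric nonnegative weight is the same for
all coordinates of a transitive code. -/
lemma sum_petals_le {petals : Finset (Finset ι)} (htr : TransitiveCode C)
    (hinv : ∀ σ : Equiv.Perm ι, (∀ x ∈ C, x ∘ σ ∈ C) → ∀ P ∈ petals, P.image σ ∈ petals)
    (W : ι → Finset ι → ℝ) (hW0 : ∀ i P, 0 ≤ W i P)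
    (hW : ∀ σ : Equiv.Perm ι, (∀ x ∈ C, x ∘ σ ∈ C) → ∀ i P, W (σ i) (P.image σ) = W i P)
    (i j : ι) :
    ∑ P ∈ petals with i ∈ P, W i P ≤ ∑ P ∈ petals with j ∈ P, W j P := by
  obtain ⟨σ, hσ, rfl⟩ := htr i j
  have hinj : Function.Injective (fun P : Finset ι => P.image σ) :=
    Finset.image_injective σ.injective
  calc _ = ∑ P ∈ petals with i ∈ P, W (σ i) (P.image σ) :=
        Finset.sum_congr rfl fun P _ => (hW σ hσ i P).symm
    _ = ∑ P ∈ (petals.filter (fun P => i ∈ P)).image (fun P => P.image σ), W (σ i) P :=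
        (Finset.sum_image hinj.injOn).symm
    _ ≤ _ := by
        refine Finset.sum_le_sum_of_subset_of_nonneg ?_ fun P _ _ => hW0 _ _
        intro P hP
        obtain ⟨P', hP', rfl⟩ := Finset.mem_image.1 hP
        obtain ⟨hmem, hi⟩ := Finset.mem_filter.1 hP'
        exact Finset.mem_filter.2 ⟨hinv σ hσ P' hmem, Finset.mem_image_of_mem σ hi⟩

variable {E : Type*} [Fintype ι] [Fintype E] {q eps : E → ℝ}

lemma sum_sum_petals (petals : Finset (Finset ι)) (W : ι → Finset ι → ℝ) :
    ∑ i, ∑ P ∈ petals with i ∈ P, W i P = ∑ P ∈ petals, ∑ i ∈ P, W i P := by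
  simp only [Finset.sum_filter]
  rw [Finset.sum_comm]
  exact Finset.sum_congr rfl fun P _ => by simp

/-- Transitivity turns the average decodability over a petal into decodability of each bit. -/
lemma petal_sum_ge (hch : ChannelValid q eps) {γ : ℝ} {petals : Finset (Finset ι)}
    (htr : TransitiveCode C)
    (hinv : ∀ σ : Equiv.Perm ι, (∀ x ∈ C, x ∘ σ ∈ C) → ∀ P ∈ petals, P.image σ ∈ petals)
    (hrate : ∀ P ∈ petals, restrRate C P ≤ capacity q eps - γ) (i : ι) :
    γ * Real.log 2 * (petals.filter (fun P => i ∈ P)).card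
      ≤ ∑ P ∈ petals with i ∈ P,
        iidE (noiseP q eps) (softBit C (noiseP q eps) i (P.erase i)) := by
  set c := γ * Real.log 2 with hc
  set W : ι → Finset ι → ℝ :=
    fun i P => iidE (noiseP q eps) (softBit C (noiseP q eps) i (P.erase i)) with hWdef
  have hW : ∀ i j, ∑ P ∈ petals with i ∈ P, W i P ≤ ∑ P ∈ petals with j ∈ P, W j P := by
    refine sum_petals_le htr hinv W (fun i P => iidE_softBit_nonneg (noiseP_nonneg hch) _ _) ?_
    intro σ hσ i P
    simp only [hWdef]
    rw [← Finset.image_erase σ.injective, iidE_softBit_image hσ]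
  have hcard : ∀ i j, ((petals.filter (fun P => i ∈ P)).card : ℝ)
      ≤ (petals.filter (fun P => j ∈ P)).card := by
    intro i j
    have h := sum_petals_le htr hinv (fun _ _ => (1 : ℝ)) (fun _ _ => zero_le_one)
      (fun _ _ _ _ => rfl) i j
    simpa using h
  have hsum : c * ∑ j : ι, ((petals.filter (fun P => j ∈ P)).card : ℝ)
      ≤ ∑ j : ι, ∑ P ∈ petals with j ∈ P, W j P := by
    have h1 := sum_sum_petals petals (fun _ _ => (1 : ℝ))
    simp only [Finset.sum_const, nsmul_eq_mul, mul_one] at h1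
    rw [h1, sum_sum_petals, Finset.mul_sum]
    exact Finset.sum_le_sum fun P hP => sum_iidE_softBit_ge hch P (hrate P hP)
  rw [Finset.sum_congr rfl fun j _ => (hcard j i).antisymm (hcard i j),
    Finset.sum_congr rfl fun j _ => (hW j i).antisymm (hW i j)] at hsum
  simp only [Finset.sum_const, nsmul_eq_mul] at hsum
  have hn : (0 : ℝ) < (Finset.univ : Finset ι).card :=
    Nat.cast_pos.2 (Finset.card_pos.2 ⟨i, Finset.mem_univ i⟩)
  rw [mul_left_comm] at hsum
  exact le_of_mul_le_mul_left hsum hn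

/-- Camellia boosting, with a bound linear in the correlation. -/
lemma errP_erase_le (hch : ChannelValid q eps) {γ : ℝ} (hγ : 0 < γ)
    {petals : Finset (Finset ι)} {ρ : ℝ} (htr : TransitiveCode C)
    (hinv : ∀ σ : Equiv.Perm ι, (∀ x ∈ C, x ∘ σ ∈ C) → ∀ P ∈ petals, P.image σ ∈ petals)
    (hcov : ∀ i : ι, ∃ P ∈ petals, i ∈ P)
    (hrate : ∀ P ∈ petals, restrRate C P ≤ capacity q eps - γ) (hρ : 0 ≤ ρ)
    (hcorr : ∀ i j : ι, i ≠ j → ((petals.filter (fun P => i ∈ P ∧ j ∈ P)).card : ℝ)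
      ≤ ρ * ((petals.filter (fun P => i ∈ P)).card : ℝ)) (i : ι) :
    errP C q eps i (Finset.univ.erase i) ≤ ρ / (γ * Real.log 2) ^ 2 := by
  have hp0 := noiseP_nonneg hch
  have hp1 := sum_noiseP hch
  set p := noiseP q eps with hp
  set c := γ * Real.log 2 with hc
  have hc0 : 0 < c := mul_pos hγ (Real.log_pos one_lt_two)
  set s := petals.filter (fun P => i ∈ P) with hs
  set d : ℝ := (s.card : ℝ) with hd
  have hd0 : 0 < d := by
    obtain ⟨P, hP, hi⟩ := hcov i
    exact Nat.cast_pos.2 (Finset.card_pos.2 ⟨P, Finset.mem_filter.2 ⟨hP, hi⟩⟩)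
  set f : Finset ι → (ι → E × ZMod 2) → ℝ := fun P => softBit C p i (P.erase i) with hf
  set F : (ι → E × ZMod 2) → ℝ := fun z => ∑ P ∈ s, f P z with hF
  have hFmean : iidE p F = ∑ P ∈ s, iidE p (f P) := iidE_sum p s f
  have hmean : c * d ≤ iidE p F := by
    rw [hFmean]
    exact petal_sum_ge hch htr hinv hrate i
  have hmean0 : 0 < iidE p F := (mul_pos hc0 hd0).trans_le hmean
  have hdeg : ∀ j, ((s.filter fun P => j ∈ P.erase i).card : ℝ) ≤ ρ * d := by
    intro j
    rcases eq_or_ne i j with rfl | hij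
    · simpa using mul_nonneg hρ hd0.le
    · refine le_trans ?_ (hcorr i j hij)
      rw [hs, Finset.filter_filter]
      refine Nat.cast_le.2 (Finset.card_le_card fun P hP => ?_)
      simp only [Finset.mem_filter, Finset.mem_erase] at hP ⊢
      exact ⟨hP.1, hP.2.1, hP.2.2.2⟩
  have hvar : iidE p (fun z => F z ^ 2) - iidE p F ^ 2 ≤ ρ * d * d := by
    have h := variance_sum_le hp0 hp1 s (fun P => P.erase i) (ρ * d) hdeg Finset.univ f
      fun P _ => (softBit_dependsOn i (P.erase i)).mono fun j hj => ⟨Finset.mem_univ j, hj⟩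
    rw [hFmean]
    refine h.trans (mul_le_mul_of_nonneg_left ?_ (mul_nonneg hρ hd0.le))
    calc _ ≤ ∑ P ∈ s, (1 : ℝ) := by
          refine Finset.sum_le_sum fun P _ => ?_
          have hsq : iidE p (fun z => f P z ^ 2) ≤ iidE p (fun _ : ι → E × ZMod 2 => 1) :=
            iidE_mono hp0 fun z _ => (sq_le_one_iff_abs_le_one _).2 (abs_softBit_le hp0 _ _ z)
          rw [iidE_const hp1] at hsq
          linarith [sq_nonneg (iidE p (f P))]
      _ = d := by simp [hd]
  have hFdep : DependsOn F ((Finset.univ.erase i : Finset ι) : Set ι) := by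
    intro y z hyz
    refine Finset.sum_congr rfl fun P _ => softBit_dependsOn i (P.erase i) fun j hj => hyz j ?_
    simp only [Finset.coe_erase, Set.mem_sdiff, Finset.mem_coe, Finset.mem_univ, true_and] at hj ⊢
    exact hj.2
  have hFcov : ∀ (x : C) z,
      F (outputOf (x : ι → ZMod 2) z) = bitSign ((x : ι → ZMod 2) i) * F z := by
    intro x z
    simp only [hF, hf, softBit_outputOf, Finset.mul_sum]
  refine (errP_le_iidE_nonpos hch i _ hFdep hFcov).trans
    ((chebyshev_nonpos hp0 hp1 F hmean0).trans ?_)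
  rw [div_le_div_iff₀ (by positivity) (by positivity)]
  have h1 : (c * d) ^ 2 ≤ iidE p F ^ 2 := pow_le_pow_left₀ (by positivity) hmean 2
  calc _ ≤ ρ * d * d * c ^ 2 := mul_le_mul_of_nonneg_right hvar (sq_nonneg c)
    _ = ρ * (c * d) ^ 2 := by ring
    _ ≤ _ := mul_le_mul_of_nonneg_left h1 hρ

end Camellia

open Classical in
/-- Main theorem (camellia boosting): for a symmetric channel of capacity `C` and a camellia
code of rate `R < C` with expansion `δ_n = C - R - Ω(1)` (gap `γ > 0`) and correlation
`ρ_n = o_n(1)`, the local error probability satisfies `P_loc = O(√ρ_n) = o_n(1)`.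
The constants `K, ρ₀` depend only on the channel and `γ`, not on the blocklength. -/
theorem stmt15 {E : Type*} [Fintype E] (q eps : E → ℝ) (hch : ChannelValid q eps)
    (γ : ℝ) (hγ : 0 < γ) :
    ∃ K > (0 : ℝ), ∃ ρ0 > (0 : ℝ),
      ∀ (ι : Type) [Fintype ι] [DecidableEq ι]
        (C : Submodule (ZMod 2) (ι → ZMod 2)) (petals : Finset (Finset ι)) (ρ : ℝ),
        rate C < capacity q eps →
        TransitiveCode C →
        (∀ σ : Equiv.Perm ι, (∀ x ∈ C, x ∘ σ ∈ C) → ∀ P ∈ petals, P.image σ ∈ petals) →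
        (∀ i : ι, ∃ P ∈ petals, i ∈ P) →
        (∀ P ∈ petals, restrRate C P ≤ rate C + (capacity q eps - rate C - γ)) →
        0 ≤ ρ → ρ ≤ ρ0 →
        (∀ i j : ι, i ≠ j →
          ((petals.filter (fun P => i ∈ P ∧ j ∈ P)).card : ℝ)
            ≤ ρ * ((petals.filter (fun P => i ∈ P)).card : ℝ)) →
        ∀ i : ι, Ploc C q eps i ≤ K * Real.sqrt ρ := by
  have hc0 : 0 < γ * Real.log 2 := mul_pos hγ (Real.log_pos one_lt_two)
  refine ⟨((γ * Real.log 2) ^ 2)⁻¹, by positivity, 1, one_pos, ?_⟩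
  intro ι _ hdec C petals ρ _ htr hinv hcov hrate hρ hρ1 hcorr i
  obtain rfl : hdec = fun a b => Classical.propDecidable (a = b) := Subsingleton.elim _ _
  have h := errP_erase_le hch hγ htr (petals := petals) (ρ := ρ) (fun σ hσ P hP => by
    convert hinv σ hσ P hP) hcov (fun P hP => (hrate P hP).trans_eq (by ring)) hρ
    (fun i j hij => by convert hcorr i j hij) i
  have hsqrt : ρ ≤ Real.sqrt ρ := Real.le_sqrt_of_sq_le (by nlinarith)
  calc Ploc C q eps i ≤ ρ / (γ * Real.log 2) ^ 2 := by
        rw [Ploc]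
        convert h
    _ = ((γ * Real.log 2) ^ 2)⁻¹ * ρ := div_eq_inv_mul _ _
    _ ≤ _ := mul_le_mul_of_nonneg_left hsqrt (by positivity)
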